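/- Let F be defined as below and let m ≥ 1 be an integer. Then the following identity of rational functions in q holds: Σ_{n=0}^{m-1} F(n,1) = Σ_{n=1}^{m} ([3n][2n][n]^2 / ([2n-1]·(-q;q)_n^4)) · ([2n choose n]_q)^3 · q^{-(n^2+3n)/2+1}. -/

import Mathlib

open Finset Polynomial

/-- The variable `q`, viewed as a rational function over `ℚ`. -/
noncomputable def q : RatFunc ℚ := RatFunc.X

/-- The q-shifted factorial `(a; b)_n = (1-a)(1-ab)⋯(1-ab^{n-1})`. -/
noncomputable def qpoch (a b : RatFunc ℚ) (n : ℕ) : RatFunc ℚ :=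
  ∏ i ∈ Finset.range n, (1 - a * b ^ i)

/-- The q-integer `[m] = (1-q^m)/(1-q)` (for an arbitrary integer `m`). -/
noncomputable def qint (m : ℤ) : RatFunc ℚ := (1 - q ^ m) / (1 - q)

/-- The q-integer `[n] = 1 + q + ⋯ + q^{n-1}` as a polynomial. -/
noncomputable def qintPoly (n : ℕ) : Polynomial ℚ := ∑ i ∈ Finset.range n, Polynomial.X ^ i

/-- The central q-binomial coefficient `[2k choose k] = (q;q)_{2k}/(q;q)_k^2`. -/
noncomputable def qcb (k : ℕ) : RatFunc ℚ := qpoch q q (2 * k) / (qpoch q q k) ^ 2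

/-- Two rational functions are congruent modulo a polynomial `P` iff `P` divides the
numerator of the reduced form of their difference. -/
def ratCongr (A B : RatFunc ℚ) (P : Polynomial ℚ) : Prop := P ∣ (A - B).num

/-- The function `F(n,k)` of the q-WZ pair. -/
noncomputable def F (n : ℕ) (k : ℤ) : RatFunc ℚ :=
  qint (3 * n + 2 * k + 1) * qpoch q (q ^ 2) n * (qpoch (q ^ (2 * k + 1)) (q ^ 2) n) ^ 2 *
    q ^ (-((n : ℤ) * ((n : ℤ) + 1) / 2) - (2 * (n : ℤ) + 1) * k) /
    ((qpoch q q n) ^ 2 * qpoch (q ^ 2) (q ^ 2) n)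

/-- The function `G(n,k)` of the q-WZ pair, with the convention `1/(q^2;q^2)_m = 0`
for negative `m` (so `G(0,k) = 0`). -/
noncomputable def G (n : ℕ) (k : ℤ) : RatFunc ℚ :=
  if n = 0 then 0 else
    -((1 + q ^ ((n : ℤ) + 2 * k - 1)) * qpoch q (q ^ 2) n *
        (qpoch (q ^ (2 * k + 1)) (q ^ 2) (n - 1)) ^ 2 *
        q ^ (-((n : ℤ) * ((n : ℤ) - 1) / 2) - (2 * (n : ℤ) - 1) * k)) /
      ((1 - q) * (qpoch q q (n - 1)) ^ 2 * qpoch (q ^ 2) (q ^ 2) (n - 1))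

theorem one_sub_q_pow_ne_zero {k : ℕ} (hk : k ≠ 0) : 1 - q ^ k ≠ 0 := by
  intro h
  have h1 : (algebraMap ℚ[X] (RatFunc ℚ)) (X ^ k) = algebraMap ℚ[X] (RatFunc ℚ) 1 := by
    rw [map_pow, RatFunc.algebraMap_X, map_one]
    exact (sub_eq_zero.mp h).symm
  have h2 := congrArg Polynomial.natDegree (RatFunc.algebraMap_injective ℚ h1)
  rw [natDegree_X_pow, natDegree_one] at h2
  exact hk h2

theorem one_add_q_pow_ne_zero {k : ℕ} (hk : k ≠ 0) : 1 + q ^ k ≠ 0 := by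
  intro h
  have h1 : 1 - q ^ (k * 2) = 0 := by
    rw [pow_mul]
    linear_combination (1 - q ^ k) * h
  exact one_sub_q_pow_ne_zero (by omega) h1

theorem qpoch_succ (a b : RatFunc ℚ) (n : ℕ) :
    qpoch a b (n + 1) = qpoch a b n * (1 - a * b ^ n) :=
  Finset.prod_range_succ _ _

theorem qpoch_succ' (a b : RatFunc ℚ) (n : ℕ) :
    qpoch a b (n + 1) = (1 - a) * qpoch (a * b) b n := by
  simp only [qpoch]
  rw [Finset.prod_range_succ', mul_comm]
  congr 1
  · simp
  · exact Finset.prod_congr rfl fun i _ => by ring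

theorem qpoch_two_mul (a b : RatFunc ℚ) (n : ℕ) :
    qpoch a b (2 * n) = qpoch a (b ^ 2) n * qpoch (a * b) (b ^ 2) n := by
  induction n with
  | zero => simp [qpoch]
  | succ n ih =>
    rw [show 2 * (n + 1) = 2 * n + 1 + 1 by ring, qpoch_succ, qpoch_succ, ih, qpoch_succ,
      qpoch_succ]
    ring

theorem qpoch_sq_sq (a b : RatFunc ℚ) (n : ℕ) :
    qpoch (a ^ 2) (b ^ 2) n = qpoch a b n * qpoch (-a) b n := by
  simp only [qpoch]
  rw [← Finset.prod_mul_distrib]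
  exact Finset.prod_congr rfl fun i _ => by ring

theorem qpoch_q_ne_zero (n : ℕ) : qpoch q q n ≠ 0 :=
  Finset.prod_ne_zero_iff.mpr fun i _ => by
    rw [← pow_succ']
    exact one_sub_q_pow_ne_zero i.succ_ne_zero

theorem qpoch_neg_q_ne_zero (n : ℕ) : qpoch (-q) q n ≠ 0 :=
  Finset.prod_ne_zero_iff.mpr fun i _ => by
    rw [neg_mul, sub_neg_eq_add, ← pow_succ']
    exact one_add_q_pow_ne_zero i.succ_ne_zero

theorem qint_natCast (n : ℕ) : qint n = (1 - q ^ n) / (1 - q) := by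
  rw [qint, zpow_natCast]

theorem qcb_eq (n : ℕ) :
    qcb n = qpoch q (q ^ 2) n * qpoch (-q) q n / qpoch q q n := by
  have hP := qpoch_q_ne_zero n
  rw [qcb, qpoch_two_mul, ← sq, qpoch_sq_sq]
  field_simp

/-- The summand `F(n,1)` is the `(n+1)`-st term of the series in central `q`-binomials. -/
theorem F_one_eq (n : ℕ) :
    F n 1 =
      qint (3 * (n + 1 : ℕ)) * qint (2 * (n + 1 : ℕ)) * (qint (n + 1 : ℕ)) ^ 2 /
        (qint (2 * ((n + 1 : ℕ) : ℤ) - 1) * (qpoch (-q) q (n + 1)) ^ 4) *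
        (qcb (n + 1)) ^ 3 *
        q ^ (-((((n + 1 : ℕ) : ℤ) ^ 2 + 3 * (n + 1 : ℕ)) / 2) + 1) := by
  have hexp : -((n : ℤ) * ((n : ℤ) + 1) / 2) - (2 * (n : ℤ) + 1) * 1 =
      -((((n + 1 : ℕ) : ℤ) ^ 2 + 3 * (n + 1 : ℕ)) / 2) + 1 := by
    have : (((n + 1 : ℕ) : ℤ) ^ 2 + 3 * (n + 1 : ℕ)) = n * (n + 1) + (2 * n + 2) * 2 := by
      push_cast
      ring
    rw [this, Int.add_mul_ediv_right _ _ two_ne_zero]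
    ring
  have h3 : qpoch (q ^ (2 * (1 : ℤ) + 1)) (q ^ 2) n = qpoch q (q ^ 2) (n + 1) / (1 - q) := by
    have h1 : 1 - q ≠ 0 := by simpa using one_sub_q_pow_ne_zero one_ne_zero
    rw [qpoch_succ', mul_div_cancel_left₀ _ h1, ← pow_succ']
    norm_cast
  have hA : qpoch q (q ^ 2) (n + 1) = qpoch q (q ^ 2) n * (1 - q ^ (2 * n + 1)) := by
    rw [qpoch_succ]
    ring
  have hP : qpoch q q (n + 1) = qpoch q q n * (1 - q ^ (n + 1)) := by
    rw [qpoch_succ]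
    ring
  have hM : qpoch (-q) q (n + 1) = qpoch (-q) q n * (1 + q ^ (n + 1)) := by
    rw [qpoch_succ]
    ring
  have e1 : 3 * (n : ℤ) + 2 * 1 + 1 = (3 * (n + 1) : ℕ) := by push_cast; ring
  have e2 : 3 * ((n + 1 : ℕ) : ℤ) = (3 * (n + 1) : ℕ) := by push_cast; ring
  have e3 : 2 * ((n + 1 : ℕ) : ℤ) = (2 * (n + 1) : ℕ) := by push_cast; ring
  have e4 : ((2 * (n + 1) : ℕ) : ℤ) - 1 = (2 * n + 1 : ℕ) := by push_cast; ring
  have e5 : 1 - q ^ (2 * (n + 1)) = (1 - q ^ (n + 1)) * (1 + q ^ (n + 1)) := by ring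
  rw [F, hexp, h3, e1, e2, e3, e4, qcb_eq, qpoch_sq_sq, qint_natCast (2 * (n + 1)),
    qint_natCast (2 * n + 1), qint_natCast (n + 1), e5, hP, hM, hA]
  have p0 := qpoch_q_ne_zero n
  have m0 := qpoch_neg_q_ne_zero n
  have a1 : 1 - q ≠ 0 := by simpa using one_sub_q_pow_ne_zero one_ne_zero
  have a2 : 1 - q ^ (2 * n + 1) ≠ 0 := one_sub_q_pow_ne_zero (by omega)
  have a3 : 1 - q ^ (n + 1) ≠ 0 := one_sub_q_pow_ne_zero (by omega)
  have a4 : 1 + q ^ (n + 1) ≠ 0 := one_add_q_pow_ne_zero (by omega)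
  generalize q ^ (_ : ℤ) = Z
  generalize 1 - q ^ (2 * n + 1) = B at *
  generalize 1 - q ^ (n + 1) = C at *
  generalize 1 + q ^ (n + 1) = D at *
  field_simp

theorem stmt_18 (m : ℕ) (hm : 1 ≤ m) :
    (∑ n ∈ Finset.range m, F n 1) =
      ∑ n ∈ Finset.Icc 1 m,
        qint (3 * n) * qint (2 * n) * (qint n) ^ 2 /
          (qint (2 * (n : ℤ) - 1) * (qpoch (-q) q n) ^ 4) *
          (qcb n) ^ 3 * q ^ (-(((n : ℤ) ^ 2 + 3 * n) / 2) + 1) := by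
  rw [← Finset.Ico_add_one_right_eq_Icc, Finset.sum_Ico_eq_sum_range, Nat.add_sub_cancel]
  refine Finset.sum_congr rfl fun n _ => ?_
  rw [F_one_eq, add_comm 1 n]
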